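/- Exactness of the diamond formula for affine functions: let Φ : ℝ² → ℝ be affine, Φ(x) = α + ⟨b, x⟩ with α ∈ ℝ and b ∈ ℝ². Let x_i ≠ x_j and v₁ ≠ v₂ be points of ℝ², set c = (x_j − x_i)/‖x_j − x_i‖ and τ = (v₂ − v₁)/‖v₂ − v₁‖, and let n ∈ ℝ² be a unit vector with ⟨n, τ⟩ = 0 and ⟨c, n⟩ ≠ 0. Then the normal derivative ⟨b, n⟩ of Φ satisfies exactly ⟨b, n⟩ = (1/⟨c, n⟩) · ( (Φ(x_j) − Φ(x_i))/‖x_j − x_i‖ − ⟨τ, c⟩ · (Φ(v₂) − Φ(v₁))/‖v₂ − v₁‖ ). -/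

import Mathlib

open RealInnerProductSpace

theorem inner_eq_add_of_orthonormal_pair {E : Type*} [NormedAddCommGroup E]
    [InnerProductSpace ℝ E] [Fact (Module.finrank ℝ E = 2)] {n τ : E}
    (hn : ‖n‖ = 1) (hτ : ‖τ‖ = 1) (hnτ : inner ℝ n τ = 0) (x y : E) :
    inner ℝ x y = inner ℝ x n * inner ℝ n y + inner ℝ x τ * inner ℝ τ y := by
  have : FiniteDimensional ℝ E := .of_fact_finrank_eq_two
  have ho : Orthonormal ℝ ![n, τ] := by
    simp [Orthonormal, Pairwise, Fin.forall_fin_two, hn, hτ, hnτ, real_inner_comm n τ]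
  have hcard : Fintype.card (Fin 2) = Module.finrank ℝ E := by
    rw [Fintype.card_fin, Fact.out (p := Module.finrank ℝ E = 2)]
  let B := basisOfOrthonormalOfCardEqFinrank ho hcard
  have hB : (B : Fin 2 → E) = ![n, τ] := coe_basisOfOrthonormalOfCardEqFinrank ho hcard
  have h := (B.toOrthonormalBasis (hB ▸ ho)).sum_inner_mul_inner x y
  simpa [hB, Fin.sum_univ_two] using h.symm

theorem affine_difference_quotient_eq_inner {E : Type*} [NormedAddCommGroup E]
    [InnerProductSpace ℝ E] {α : ℝ} {b : E} {Φ : E → ℝ}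
    (hΦ : ∀ x, Φ x = α + inner ℝ b x) (x y : E) :
    (Φ y - Φ x) / ‖y - x‖ = inner ℝ b (‖y - x‖⁻¹ • (y - x)) := by
  rw [hΦ, hΦ, inner_smul_right, inner_sub_right]
  ring

/-- Exactness of the diamond formula for affine functions: for an affine function
`Φ(x) = α + ⟪b, x⟫` on `ℝ²`, with `c` the unit vector from `x_i` to `x_j`, `τ` the unit
vector from `v₁` to `v₂`, and `n` a unit vector orthogonal to `τ` with `⟪c, n⟫ ≠ 0`,
the diamond formula reproduces the normal derivative `⟪b, n⟫` exactly. -/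
theorem diamond_formula_exact_affine
    (α : ℝ) (b : EuclideanSpace ℝ (Fin 2))
    (Φ : EuclideanSpace ℝ (Fin 2) → ℝ)
    (hΦ : ∀ x, Φ x = α + ⟪b, x⟫)
    (xi xj v₁ v₂ : EuclideanSpace ℝ (Fin 2))
    (hx : xi ≠ xj) (hv : v₁ ≠ v₂)
    (c τ n : EuclideanSpace ℝ (Fin 2))
    (hcdef : c = ‖xj - xi‖⁻¹ • (xj - xi))
    (hτdef : τ = ‖v₂ - v₁‖⁻¹ • (v₂ - v₁))
    (hn : ‖n‖ = 1) (hnτ : ⟪n, τ⟫ = 0) (hcn : ⟪c, n⟫ ≠ 0) :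
    ⟪b, n⟫ = (1 / ⟪c, n⟫) *
      ((Φ xj - Φ xi) / ‖xj - xi‖ - ⟪τ, c⟫ * ((Φ v₂ - Φ v₁) / ‖v₂ - v₁‖)) := by
  have hτ : ‖τ‖ = 1 := by
    rw [hτdef]
    exact norm_smul_inv_norm (𝕜 := ℝ) (sub_ne_zero.mpr hv.symm)
  have : Fact (Module.finrank ℝ (EuclideanSpace ℝ (Fin 2)) = 2) := ⟨finrank_euclideanSpace_fin⟩
  rw [affine_difference_quotient_eq_inner hΦ, affine_difference_quotient_eq_inner hΦ,
    ← hcdef, ← hτdef, inner_eq_add_of_orthonormal_pair hn hτ hnτ b c, real_inner_comm c n]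
  field_simp
  ring
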